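/- Let T be a Calderón–Zygmund operator with normalised standard kernel of Hölder exponent γ, s ∈ ℕ, and let K, L ∈ 𝒟 with K = L∔m for some m ∈ ℤⁿ, θ ∈ {0,1}ⁿ, ζ ∈ {0,1}ⁿ∖{0}. Then, with C depending only on n, γ: |⟨h^θ_K, T_{4·2^s ℓ(L)} h^ζ_L⟩| ≤ C [ |m|^{−n−γ} · 1{|m| > 2·2^s} + |m|^{−n} · 1{ | |m| − 4·2^s | < 2 } ]. -/

import Mathlib

open MeasureTheory

noncomputable section

open Classical in
/-- Classical indicator of a proposition. -/
def indR (P : Prop) : ℝ := if P then 1 else 0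

/-- The real sign associated to a boolean. -/
def sgnB (b : Bool) : ℝ := if b then 1 else -1

/-- The `ℓ∞` norm of an integer vector, as a real number. -/
def inorm {n : ℕ} (m : Fin n → ℤ) : ℝ := ‖(fun i => (m i : ℝ) : Fin n → ℝ)‖

/-- The dyadic cube `2^{-k}([0,1)^n + m)` of generation `k` in `ℝ^n` (with the `ℓ∞` metric). -/
def dyadicCube (n : ℕ) (k : ℤ) (m : Fin n → ℤ) : Set (Fin n → ℝ) :=
  {x | ∀ i, (2:ℝ) ^ (-k) * m i ≤ x i ∧ x i < (2:ℝ) ^ (-k) * (m i + 1)}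

/-- The side length `2^{-k}` of a dyadic cube of generation `k`. -/
def sideLen (k : ℤ) : ℝ := (2:ℝ) ^ (-k)

/-- One-dimensional Haar function on the dyadic interval `2^{-k}[m, m+1)`:
the non-cancellative `h⁰` for `η = false`, the cancellative `h¹` for `η = true`. -/
def haar1D (k : ℤ) (m : ℤ) (η : Bool) (t : ℝ) : ℝ :=
  (Real.sqrt ((2:ℝ) ^ (-k)))⁻¹ *
    (if η then
        (Set.Ico ((2:ℝ) ^ (-k) * m) ((2:ℝ) ^ (-k) * (m + 1/2))).indicator 1 t
          - (Set.Ico ((2:ℝ) ^ (-k) * (m + 1/2)) ((2:ℝ) ^ (-k) * (m + 1))).indicator 1 t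
      else (Set.Ico ((2:ℝ) ^ (-k) * m) ((2:ℝ) ^ (-k) * (m + 1))).indicator 1 t)

/-- The Haar function `h^η_I` for the dyadic cube `I` indexed by `(k, m)`. -/
def haarFn (n : ℕ) (k : ℤ) (m : Fin n → ℤ) (η : Fin n → Bool) (x : Fin n → ℝ) : ℝ :=
  ∏ i, haar1D k (m i) (η i) (x i)

/-- The non-cancellative Haar function `h⁰_I = |I|^{-1/2} 1_I`. -/
def haarZero (n : ℕ) (k : ℤ) (m : Fin n → ℤ) : (Fin n → ℝ) → ℝ :=
  haarFn n k m (fun _ => false)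

/-- The pairing `⟨g, f⟩ = ∫ g f dx`. -/
def pairing {n : ℕ} (g f : (Fin n → ℝ) → ℝ) : ℝ := ∫ x, g x * f x

/-- A normalised standard kernel with Hölder exponent `γ` (with respect to the `ℓ∞` metric). -/
structure IsNormalisedKernel (n : ℕ) (γ : ℝ) (K : (Fin n → ℝ) → (Fin n → ℝ) → ℝ) : Prop where
  size : ∀ x y, x ≠ y → |K x y| ≤ dist x y ^ (-(n:ℝ))
  smooth : ∀ x y h, 2 * ‖h‖ < dist x y →
    |K (x + h) y - K x y| + |K x (y + h) - K x y| ≤ ‖h‖ ^ γ * dist x y ^ (-(n:ℝ) - γ)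

/-- The singular integral `Tf(x) = ∫ K(x,y) f(y) dy`. -/
def czIntegral {n : ℕ} (K : (Fin n → ℝ) → (Fin n → ℝ) → ℝ) (f : (Fin n → ℝ) → ℝ)
    (x : Fin n → ℝ) : ℝ := ∫ y, K x y * f y

/-- The truncated singular integral `T_ε f(x) = ∫_{|y-x|>ε} K(x,y) f(y) dy`. -/
def czTrunc {n : ℕ} (K : (Fin n → ℝ) → (Fin n → ℝ) → ℝ) (ε : ℝ) (f : (Fin n → ℝ) → ℝ)
    (x : Fin n → ℝ) : ℝ := ∫ y in {y | ε < dist x y}, K x y * f y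

/-- The dyadic conditional expectation `E_k f`. -/
def dyadicE (n : ℕ) (k : ℤ) (f : (Fin n → ℝ) → ℝ) (x : Fin n → ℝ) : ℝ :=
  (2:ℝ) ^ (k * (n:ℤ)) * ∫ y in dyadicCube n k (fun i => ⌊(2:ℝ) ^ k * x i⌋), f y

/-- The dyadic martingale difference `D_k f = E_{k+1} f - E_k f`. -/
def dyadicD (n : ℕ) (k : ℤ) (f : (Fin n → ℝ) → ℝ) (x : Fin n → ℝ) : ℝ :=
  dyadicE n (k+1) f x - dyadicE n k f x

/-- The centre of the dyadic cube indexed by `(k, m)`. -/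
def cubeCenter (n : ℕ) (k : ℤ) (m : Fin n → ℤ) : Fin n → ℝ :=
  fun i => (2:ℝ) ^ (-k) * (m i + 1/2)

/-- The concentric `c`-fold expansion of the dyadic cube indexed by `(k, m)`. -/
def expandCube (n : ℕ) (k : ℤ) (m : Fin n → ℤ) (c : ℝ) : Set (Fin n → ℝ) :=
  {x | ∀ i, |x i - cubeCenter n k m i| ≤ c * (2:ℝ) ^ (-k) / 2}

/-- The set `Σ_{f,s} = ⋃_k 9Ω_k`, where `Ω_k` is the union of the cubes `I ∈ 𝒟_k` on which
`D_{k+s} f` is not a.e. zero. -/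
def SigmaSet (n : ℕ) (f : (Fin n → ℝ) → ℝ) (s : ℕ) : Set (Fin n → ℝ) :=
  ⋃ (k : ℤ) (m : Fin n → ℤ)
    (_ : ¬ (∀ᵐ x ∂(volume.restrict (dyadicCube n k m)), dyadicD n (k + (s:ℤ)) f x = 0)),
      expandCube n k m 9

/-- The (measure-theoretic) support of a measurable function: the complement of the union of
all balls on which the function vanishes a.e. -/
def suppAE {n : ℕ} (f : (Fin n → ℝ) → ℝ) : Set (Fin n → ℝ) :=
  {x | ∀ r > 0, ¬ (∀ᵐ y ∂(volume.restrict (Metric.ball x r)), f y = 0)}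

/-- The axis-parallel closed cube with centre `c` and side length `ρ`. -/
def cube (n : ℕ) (c : Fin n → ℝ) (ρ : ℝ) : Set (Fin n → ℝ) :=
  {x | ∀ i, |x i - c i| ≤ ρ / 2}

/-- The index of the `s`-th dyadic ancestor `I^{(s)}` of the cube indexed by `(k, m)`
(the ancestor is the cube indexed by `(k - s, ancestorIdx s m)`). -/
def ancestorIdx {n : ℕ} (s : ℕ) (m : Fin n → ℤ) : Fin n → ℤ :=
  fun i => Int.fdiv (m i) (2 ^ s)

/-- The distance between two sets (in the ambient metric). -/
def setDist {α : Type*} [PseudoMetricSpace α] (A B : Set α) : ℝ :=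
  sInf (Set.image2 dist A B)

lemma sideLen_pos (k : ℤ) : 0 < sideLen k := zpow_pos two_pos _

lemma dyadicCube_eq_pi (n : ℕ) (k : ℤ) (m : Fin n → ℤ) :
    dyadicCube n k m =
      Set.pi Set.univ fun i => Set.Ico (sideLen k * m i) (sideLen k * (m i + 1)) := by
  ext x
  simp [dyadicCube, sideLen, Set.mem_pi]

lemma volume_real_dyadicCube (n : ℕ) (k : ℤ) (m : Fin n → ℤ) :
    volume.real (dyadicCube n k m) = sideLen k ^ n := by
  have hk := sideLen_pos k
  rw [dyadicCube_eq_pi, measureReal_def, Real.volume_pi_Ico_toReal]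
  · simp [mul_add]
  · intro i
    simp only
    nlinarith

lemma volume_dyadicCube_lt_top (n : ℕ) (k : ℤ) (m : Fin n → ℤ) :
    volume (dyadicCube n k m) < ⊤ := by
  rw [dyadicCube_eq_pi, Real.volume_pi_Ico]
  exact ENNReal.prod_lt_top fun i _ => ENNReal.ofReal_lt_top

lemma haar1D_eq_zero {k m : ℤ} {η : Bool} {t : ℝ}
    (ht : t ∉ Set.Ico (sideLen k * m) (sideLen k * (m + 1))) : haar1D k m η t = 0 := by
  have hk := sideLen_pos k
  have h1 : t ∉ Set.Ico (sideLen k * m) (sideLen k * (m + 1 / 2)) := fun h =>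
    ht ⟨h.1, h.2.trans (by nlinarith)⟩
  have h2 : t ∉ Set.Ico (sideLen k * (m + 1 / 2)) (sideLen k * (m + 1)) := fun h =>
    ht ⟨le_trans (by nlinarith) h.1, h.2⟩
  unfold sideLen at ht h1 h2
  unfold haar1D
  rw [Set.indicator_of_notMem ht, Set.indicator_of_notMem h1, Set.indicator_of_notMem h2]
  simp

lemma abs_haar1D_le (k m : ℤ) (η : Bool) (t : ℝ) :
    |haar1D k m η t| ≤ (Real.sqrt (sideLen k))⁻¹ := by
  unfold haar1D sideLen
  rw [abs_mul, abs_of_nonneg (inv_nonneg.2 (Real.sqrt_nonneg _))]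
  refine mul_le_of_le_one_right (inv_nonneg.2 (Real.sqrt_nonneg _)) ?_
  simp only [Set.indicator_apply, Set.mem_Ico, Pi.one_apply]
  split_ifs <;> norm_num

lemma integrable_indicator_Ico_one (a b : ℝ) :
    Integrable ((Set.Ico a b).indicator (1 : ℝ → ℝ)) := by
  rw [integrable_indicator_iff measurableSet_Ico]
  exact integrableOn_const (by simp)

lemma integrable_haar1D (k m : ℤ) (η : Bool) : Integrable (haar1D k m η) := by
  unfold haar1D
  refine Integrable.const_mul ?_ _
  cases η
  · simpa using integrable_indicator_Ico_one _ _
  · exact (integrable_indicator_Ico_one _ _).sub (integrable_indicator_Ico_one _ _)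

lemma integral_haar1D_true (k m : ℤ) : ∫ t, haar1D k m true t = 0 := by
  have hk := sideLen_pos k
  unfold sideLen at hk
  simp only [haar1D, if_true]
  rw [integral_const_mul, integral_sub (integrable_indicator_Ico_one _ _)
    (integrable_indicator_Ico_one _ _), integral_indicator_one measurableSet_Ico,
    integral_indicator_one measurableSet_Ico, Real.volume_real_Ico_of_le (by nlinarith),
    Real.volume_real_Ico_of_le (by nlinarith)]
  ring

lemma haarFn_eq_zero {n : ℕ} {k : ℤ} {m : Fin n → ℤ} {η : Fin n → Bool} {x : Fin n → ℝ}
    (hx : x ∉ dyadicCube n k m) : haarFn n k m η x = 0 := by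
  rw [dyadicCube_eq_pi, Set.mem_univ_pi] at hx
  push Not at hx
  obtain ⟨i, hi⟩ := hx
  exact Finset.prod_eq_zero (Finset.mem_univ i) (haar1D_eq_zero hi)

lemma abs_haarFn_le (n : ℕ) (k : ℤ) (m : Fin n → ℤ) (η : Fin n → Bool) (x : Fin n → ℝ) :
    |haarFn n k m η x| ≤ (Real.sqrt (sideLen k))⁻¹ ^ n := by
  rw [haarFn, Finset.abs_prod]
  refine (Finset.prod_le_prod (fun i _ => abs_nonneg _)
    fun i _ => abs_haar1D_le k (m i) (η i) (x i)).trans ?_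
  simp

lemma integrable_haarFn (n : ℕ) (k : ℤ) (m : Fin n → ℤ) (η : Fin n → Bool) :
    Integrable (haarFn n k m η) :=
  Integrable.fintype_prod fun i => integrable_haar1D k (m i) (η i)

lemma integral_haarFn_eq_zero (n : ℕ) (k : ℤ) (m : Fin n → ℤ) (η : Fin n → Bool)
    (hη : η ≠ fun _ => false) : ∫ x, haarFn n k m η x = 0 := by
  obtain ⟨i, hi⟩ := Function.ne_iff.1 hη
  unfold haarFn
  rw [integral_fintype_prod_volume_eq_prod (fun i => haar1D k (m i) (η i))]
  refine Finset.prod_eq_zero (Finset.mem_univ i) ?_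
  rw [Bool.eq_true_of_not_eq_false hi, integral_haar1D_true]

/-- A function vanishing off a dyadic cube and bounded by `c` there has integral at most
`c` times the volume of the cube, measurable or not. -/
lemma abs_integral_le_of_dyadicCube {n : ℕ} {k : ℤ} {m : Fin n → ℤ} {f : (Fin n → ℝ) → ℝ} {c : ℝ}
    (h0 : ∀ x ∉ dyadicCube n k m, f x = 0) (hc : ∀ x ∈ dyadicCube n k m, |f x| ≤ c) :
    |∫ x, f x| ≤ c * sideLen k ^ n := by
  rw [← setIntegral_eq_integral_of_forall_compl_eq_zero h0, ← volume_real_dyadicCube n k m]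
  exact norm_setIntegral_le_of_norm_le_const (f := f) (volume_dyadicCube_lt_top n k m) hc

lemma inv_sqrt_pow_mul_self_mul_pow {a : ℝ} (ha : 0 < a) (n : ℕ) :
    (Real.sqrt a)⁻¹ ^ n * (Real.sqrt a)⁻¹ ^ n * a ^ n = 1 := by
  rw [← mul_pow, ← mul_pow, ← mul_inv, Real.mul_self_sqrt ha.le, inv_mul_cancel₀ ha.ne', one_pow]

/-- Pairing with a Haar function loses nothing when the other factor is bounded by `D` times
the `L¹` norm of a Haar function of the same generation. -/
lemma abs_pairing_haarFn_le {n : ℕ} {k : ℤ} {m : Fin n → ℤ} {θ : Fin n → Bool}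
    {g : (Fin n → ℝ) → ℝ} {D : ℝ}
    (hg : ∀ x ∈ dyadicCube n k m, |g x| ≤ D * (Real.sqrt (sideLen k))⁻¹ ^ n * sideLen k ^ n) :
    |pairing (haarFn n k m θ) g| ≤ D * sideLen k ^ n := by
  have hA : 0 ≤ (Real.sqrt (sideLen k))⁻¹ ^ n := by positivity
  have h := abs_integral_le_of_dyadicCube (k := k) (m := m) (f := fun x => haarFn n k m θ x * g x)
    (c := (Real.sqrt (sideLen k))⁻¹ ^ n * (D * (Real.sqrt (sideLen k))⁻¹ ^ n * sideLen k ^ n))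
    (fun x hx => by simp [haarFn_eq_zero hx])
    (fun x hx => by
      rw [abs_mul]
      exact mul_le_mul (abs_haarFn_le n k m θ x) (hg x hx) (abs_nonneg _) hA)
  refine h.trans_eq ?_
  linear_combination (D * sideLen k ^ n) * inv_sqrt_pow_mul_self_mul_pow (sideLen_pos k) n

section Distance

variable {n : ℕ} {k : ℤ} {a m : Fin n → ℤ} {x y : Fin n → ℝ}

lemma abs_le_inorm (m : Fin n → ℤ) (i : Fin n) : |(m i : ℝ)| ≤ inorm m :=
  norm_le_pi_norm (fun i => (m i : ℝ)) i

lemma inorm_nonneg (m : Fin n → ℤ) : 0 ≤ inorm m := norm_nonneg _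

lemma abs_sub_sub_lt_of_mem_dyadicCube (hx : x ∈ dyadicCube n k (a + m))
    (hy : y ∈ dyadicCube n k a) (i : Fin n) :
    |x i - y i - sideLen k * m i| < sideLen k := by
  obtain ⟨h1, h2⟩ := hx i
  obtain ⟨h3, h4⟩ := hy i
  simp only [Pi.add_apply, Int.cast_add] at h1 h2
  rw [abs_lt]
  unfold sideLen
  constructor <;> linarith

lemma dist_le_of_mem_dyadicCube (hx : x ∈ dyadicCube n k (a + m)) (hy : y ∈ dyadicCube n k a) :
    dist x y ≤ sideLen k * (inorm m + 1) := by
  have hk := sideLen_pos k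
  refine (dist_pi_le_iff (mul_nonneg hk.le (by linarith [inorm_nonneg m]))).2 fun i => ?_
  have h1 := abs_sub_sub_lt_of_mem_dyadicCube hx hy i
  have h2 := mul_le_mul_of_nonneg_left (abs_le_inorm m i) hk.le
  have h3 := abs_add_le (x i - y i - sideLen k * m i) (sideLen k * m i)
  rw [abs_mul, abs_of_pos hk, sub_add_cancel] at h3
  rw [Real.dist_eq]
  linarith

lemma lt_dist_of_mem_dyadicCube (hx : x ∈ dyadicCube n k (a + m)) (hy : y ∈ dyadicCube n k a) :
    sideLen k * (inorm m - 1) < dist x y := by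
  have hk := sideLen_pos k
  have h : inorm m < dist x y / sideLen k + 1 := by
    refine (pi_norm_lt_iff (by positivity)).2 fun i => ?_
    have h1 := abs_sub_sub_lt_of_mem_dyadicCube hx hy i
    have h2 : |x i - y i| ≤ dist x y := dist_le_pi_dist x y i
    have h3 := abs_sub_abs_le_abs_sub (sideLen k * m i) (x i - y i)
    rw [abs_mul, abs_of_pos hk, abs_sub_comm (sideLen k * (m i : ℝ))] at h3
    rw [Real.norm_eq_abs, ← sub_lt_iff_lt_add, lt_div_iff₀ hk]
    linarith
  rw [← sub_lt_iff_lt_add, lt_div_iff₀ hk] at h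
  linarith

lemma dist_le_sideLen (hx : x ∈ dyadicCube n k a) (hy : y ∈ dyadicCube n k a) :
    dist x y ≤ sideLen k := by
  have h := dist_le_of_mem_dyadicCube (a := a) (m := 0) (by simpa using hx) hy
  simpa [inorm, ← Pi.zero_def] using h

end Distance

section Truncation

variable {n : ℕ} {ε : ℝ} {K : (Fin n → ℝ) → (Fin n → ℝ) → ℝ} {k : ℤ} {a m : Fin n → ℤ}
  {ζ : Fin n → Bool} {x : Fin n → ℝ}

lemma measurableSet_lt_dist (x : Fin n → ℝ) (ε : ℝ) : MeasurableSet {y | ε < dist x y} :=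
  (isOpen_lt continuous_const (by fun_prop)).measurableSet

lemma czTrunc_haarFn_eq_zero (hε : sideLen k * (inorm m + 1) ≤ ε)
    (hx : x ∈ dyadicCube n k (a + m)) : czTrunc K ε (haarFn n k a ζ) x = 0 := by
  refine setIntegral_eq_zero_of_forall_eq_zero fun y hy => ?_
  rw [haarFn_eq_zero, mul_zero]
  intro hya
  exact absurd hy (not_lt.2 ((dist_le_of_mem_dyadicCube hx hya).trans hε))

lemma abs_czTrunc_haarFn_le_of_abs_le {D : ℝ} (hD : 0 ≤ D)
    (hK : ∀ y ∈ dyadicCube n k a, |K x y| ≤ D) :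
    |czTrunc K ε (haarFn n k a ζ) x| ≤
      D * (Real.sqrt (sideLen k))⁻¹ ^ n * sideLen k ^ n := by
  have hA : 0 ≤ (Real.sqrt (sideLen k))⁻¹ ^ n := by positivity
  rw [czTrunc, ← integral_indicator (measurableSet_lt_dist x ε)]
  refine abs_integral_le_of_dyadicCube (m := a)
    (fun y hy => by simp [Set.indicator_apply, haarFn_eq_zero hy]) fun y hy => ?_
  refine (norm_indicator_le_norm_self (fun y => K x y * haarFn n k a ζ y) y).trans ?_
  rw [Real.norm_eq_abs, abs_mul]
  exact mul_le_mul (hK y hy) (abs_haarFn_le n k a ζ y) (abs_nonneg _) hD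

/-- The cancellation of the Haar function lets one subtract a constant from the kernel. -/
lemma abs_czTrunc_haarFn_le_of_abs_sub_le {D : ℝ} (hD : 0 ≤ D) (c : ℝ)
    (hζ : ζ ≠ fun _ => false) (hε : ∀ y ∈ dyadicCube n k a, ε < dist x y)
    (hK : ∀ y ∈ dyadicCube n k a, |K x y - c| ≤ D) :
    |czTrunc K ε (haarFn n k a ζ) x| ≤
      D * (Real.sqrt (sideLen k))⁻¹ ^ n * sideLen k ^ n := by
  have hk := sideLen_pos k
  rw [czTrunc, setIntegral_eq_integral_of_forall_compl_eq_zero (fun y hy => by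
    rw [haarFn_eq_zero fun h => hy (hε y h), mul_zero])]
  by_cases hint : Integrable fun y => K x y * haarFn n k a ζ y
  · have hsub : ∫ y, K x y * haarFn n k a ζ y =
        ∫ y, (K x y * haarFn n k a ζ y - c * haarFn n k a ζ y) := by
      rw [integral_sub hint ((integrable_haarFn n k a ζ).const_mul c), integral_const_mul,
        integral_haarFn_eq_zero n k a ζ hζ, mul_zero, sub_zero]
    rw [hsub]
    refine abs_integral_le_of_dyadicCube (m := a)
      (fun y hy => by simp [haarFn_eq_zero hy]) fun y hy => ?_
    rw [← sub_mul, abs_mul]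
    exact mul_le_mul (hK y hy) (abs_haarFn_le n k a ζ y) (abs_nonneg _) hD
  · rw [integral_undef hint, abs_zero]
    positivity

end Truncation

lemma indR_nonneg (P : Prop) : 0 ≤ indR P := by
  unfold indR
  split_ifs <;> norm_num

lemma mul_half_rpow_neg_mul {l r p : ℝ} (hl : 0 < l) (hr : 0 < r) :
    (l * (r / 2)) ^ (-p) = 2 ^ p * l ^ (-p) * r ^ (-p) := by
  rw [Real.mul_rpow hl.le (by positivity), Real.div_rpow hr.le two_pos.le,
    Real.rpow_neg two_pos.le, div_inv_eq_mul]
  ring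

lemma IsNormalisedKernel.abs_sub_right_le {n : ℕ} {γ : ℝ}
    {K : (Fin n → ℝ) → (Fin n → ℝ) → ℝ} (hK : IsNormalisedKernel n γ K) {x y z : Fin n → ℝ}
    (h : 2 * dist z y < dist x y) :
    |K x z - K x y| ≤ dist z y ^ γ * dist x y ^ (-(n : ℝ) - γ) := by
  rw [dist_eq_norm z y] at h ⊢
  have h1 := hK.smooth x y (z - y) h
  rw [add_sub_cancel] at h1
  exact (le_add_of_nonneg_left (abs_nonneg _)).trans h1

/-- Lemma 5.4: bound for `⟨h^θ_K, T_{4·2^s ℓ(L)} h^ζ_L⟩` with `K = L∔m`. -/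
theorem statement14 (n : ℕ) (hn : 0 < n) (γ : ℝ) (hγ0 : 0 < γ) (hγ1 : γ ≤ 1) :
    ∃ C : ℝ, 0 < C ∧
      ∀ K : (Fin n → ℝ) → (Fin n → ℝ) → ℝ, IsNormalisedKernel n γ K →
      ∀ (s : ℕ) (k : ℤ) (mL m : Fin n → ℤ) (θ ζ : Fin n → Bool), ζ ≠ (fun _ => false) →
        |pairing (haarFn n k (mL + m) θ)
            (czTrunc K (4 * 2^s * sideLen k) (haarFn n k mL ζ))| ≤
          C * (indR (2 * 2^s < inorm m) * inorm m ^ (-(n:ℝ) - γ) +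
              indR (|inorm m - 4 * 2^s| < 2) * inorm m ^ (-(n:ℝ))) := by
  refine ⟨2 ^ ((n : ℝ) + γ), by positivity, ?_⟩
  intro K hK s k a m θ ζ hζ
  have hl := sideLen_pos k
  have hs : (1 : ℝ) ≤ 2 ^ s := one_le_pow₀ one_le_two
  have hr0 := inorm_nonneg m
  set l := sideLen k
  set r := inorm m
  have hC : (0 : ℝ) < 2 ^ ((n : ℝ) + γ) := by positivity
  have hfar : 0 ≤ indR (2 * 2 ^ s < r) * r ^ (-(n : ℝ) - γ) :=
    mul_nonneg (indR_nonneg _) (Real.rpow_nonneg hr0 _)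
  have hnear : 0 ≤ indR (|r - 4 * 2 ^ s| < 2) * r ^ (-(n : ℝ)) :=
    mul_nonneg (indR_nonneg _) (Real.rpow_nonneg hr0 _)
  rcases le_or_gt (r + 1) (4 * 2 ^ s) with hr | hr
  · have h : |pairing (haarFn n k (a + m) θ) (czTrunc K (4 * 2 ^ s * l) (haarFn n k a ζ))| ≤
        0 * l ^ n := abs_pairing_haarFn_le fun x hx => by
      rw [czTrunc_haarFn_eq_zero (m := m) (by rw [mul_comm (4 * 2 ^ s) l]; gcongr) hx]
      simp
    rw [zero_mul] at h
    exact h.trans (mul_nonneg hC.le (add_nonneg hfar hnear))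
  have hrpos : 0 < r := by linarith
  have hhalf : ∀ x ∈ dyadicCube n k (a + m), ∀ y ∈ dyadicCube n k a,
      l * (r / 2) ≤ dist x y := fun x hx y hy =>
    le_trans (by gcongr; linarith) (lt_dist_of_mem_dyadicCube hx hy).le
  rcases le_or_gt (4 * 2 ^ s) (r - 1) with hr' | hr'
  · have h : |pairing (haarFn n k (a + m) θ) (czTrunc K (4 * 2 ^ s * l) (haarFn n k a ζ))| ≤
        (l ^ γ * (l * (r / 2)) ^ (-(n : ℝ) - γ)) * l ^ n := abs_pairing_haarFn_le fun x hx => by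
      have hc : (fun i => l * a i) ∈ dyadicCube n k a := fun i =>
        ⟨le_rfl, mul_lt_mul_of_pos_left (lt_add_one _) hl⟩
      refine abs_czTrunc_haarFn_le_of_abs_sub_le (by positivity) (K x fun i => l * a i) hζ
        (fun y hy => ?_) fun y hy => ?_
      · refine lt_of_le_of_lt ?_ (lt_dist_of_mem_dyadicCube hx hy)
        rw [mul_comm (4 * 2 ^ s) l]
        gcongr
      · have hd := dist_le_sideLen hy hc
        refine (hK.abs_sub_right_le ?_).trans ?_
        · have := lt_dist_of_mem_dyadicCube hx hc
          nlinarith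
        · have h2 := hhalf x hx _ hc
          gcongr ?_ * ?_
          · exact Real.rpow_le_rpow dist_nonneg hd hγ0.le
          · exact Real.rpow_le_rpow_of_nonpos (by positivity) h2
              (by linarith [n.cast_nonneg (α := ℝ)])
    refine h.trans ?_
    have e : (l ^ γ * (l * (r / 2)) ^ (-(n : ℝ) - γ)) * l ^ n =
        2 ^ ((n : ℝ) + γ) * r ^ (-(n : ℝ) - γ) := by
      rw [← neg_add', mul_half_rpow_neg_mul hl hrpos, ← Real.rpow_natCast l n]
      have : l ^ γ * l ^ (-((n : ℝ) + γ)) * l ^ (n : ℝ) = 1 := by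
        rw [← Real.rpow_add hl, ← Real.rpow_add hl]
        convert Real.rpow_zero l using 2
        ring
      linear_combination (2 ^ ((n : ℝ) + γ) * r ^ (-((n : ℝ) + γ))) * this
    rw [e]
    have hind : indR (2 * 2 ^ s < r) = 1 := if_pos (by linarith)
    rw [hind, one_mul]
    gcongr
    linarith
  · have h : |pairing (haarFn n k (a + m) θ) (czTrunc K (4 * 2 ^ s * l) (haarFn n k a ζ))| ≤
        (l * (r / 2)) ^ (-(n : ℝ)) * l ^ n := abs_pairing_haarFn_le fun x hx => by
      refine abs_czTrunc_haarFn_le_of_abs_le (by positivity) fun y hy => ?_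
      have h2 := hhalf x hx y hy
      have h3 : 0 < l * (r / 2) := by positivity
      exact (hK.size x y (dist_pos.1 (h3.trans_le h2))).trans
        (Real.rpow_le_rpow_of_nonpos h3 h2 (by linarith [n.cast_nonneg (α := ℝ)]))
    refine h.trans ?_
    have e : (l * (r / 2)) ^ (-(n : ℝ)) * l ^ n = 2 ^ (n : ℝ) * r ^ (-(n : ℝ)) := by
      rw [mul_half_rpow_neg_mul hl hrpos, ← Real.rpow_natCast l n]
      have : l ^ (-(n : ℝ)) * l ^ (n : ℝ) = 1 := by
        rw [← Real.rpow_add hl, neg_add_cancel, Real.rpow_zero]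
      linear_combination (2 ^ (n : ℝ) * r ^ (-(n : ℝ))) * this
    rw [e]
    have hind : indR (|r - 4 * 2 ^ s| < 2) = 1 :=
      if_pos (abs_lt.2 ⟨by linarith, by linarith⟩)
    rw [hind, one_mul]
    have h2 : (2 : ℝ) ^ (n : ℝ) ≤ 2 ^ ((n : ℝ) + γ) :=
      Real.rpow_le_rpow_of_exponent_le one_le_two (by linarith)
    have h3 : 0 ≤ r ^ (-(n : ℝ)) := Real.rpow_nonneg hr0 _
    calc (2 : ℝ) ^ (n : ℝ) * r ^ (-(n : ℝ)) ≤ 2 ^ ((n : ℝ) + γ) * r ^ (-(n : ℝ)) := by gcongr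
      _ ≤ _ := by
        gcongr
        linarith

end
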